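/- Let m≥1 and β=(β_1,…,β_m), where either m=1 and β_1>−1, or m≥2 and β∈[0,∞)^m. There is a constant C>0 depending only on m and β such that for every v∈S_+^{m−1} and every s with −‖v‖_1<s<‖v‖_1 (and additionally s≥0 when m=1) one has Vol_{m−1}(C(v,s);β) ≤ C·(‖v‖_1−s)^{−1}·∏_{i=1}^m (min{(‖v‖_1−s)/(2v_i),1})^{β_i+1}, where for v_i=0 the minimum is interpreted as 1. -/

import Mathlib

open MeasureTheory Filter
open scoped RealInnerProductSpace

noncomputable section

/-- Normalizing constant `c_β = c_{β,1}` of the one-dimensional beta density on `[−1,1]`. -/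
def betaConst1 (β : ℝ) : ℝ :=
  Real.Gamma (3 / 2 + β) / (Real.pi ^ ((1 : ℝ) / 2) * Real.Gamma (β + 1))

/-- The meta-section `C(v,s) = [−1,1]^m ∩ H(v,s)`. -/
def metaSection {m : ℕ} (v : EuclideanSpace ℝ (Fin m)) (s : ℝ) :
    Set (EuclideanSpace ℝ (Fin m)) :=
  {y | (∀ i, |y i| ≤ 1) ∧ ⟪y, v⟫ = s}

/-- The `β`-weighted `(m−1)`-dimensional Hausdorff measure
`Vol_{m−1}(C(v,s);β) = ∫_{C(v,s)} ∏_i c_{β_i}(1−y_i²)^{β_i} dH^{m−1}(y)`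
of the meta-section. -/
def metaSectionContent {m : ℕ} (β : Fin m → ℝ) (v : EuclideanSpace ℝ (Fin m))
    (s : ℝ) : ℝ :=
  ∫ y in metaSection v s, (∏ i, betaConst1 (β i) * (1 - y i ^ 2) ^ (β i))
    ∂(μH[(m : ℝ) - 1])

/-- The truncated ratio `min (t / (2 a)) 1`, read as `1` when `a = 0`. -/
def cutoff (t a : ℝ) : ℝ := if a = 0 then 1 else min (t / (2 * a)) 1

lemma cutoff_pos {t a : ℝ} (ht : 0 < t) (ha : 0 ≤ a) : 0 < cutoff t a := by
  unfold cutoff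
  split_ifs with h
  · exact one_pos
  · have : 0 < a := lt_of_le_of_ne ha (Ne.symm h)
    exact lt_min (by positivity) one_pos

lemma le_two_mul_cutoff {t a u : ℝ} (ha : 0 ≤ a) (hu : u ≤ 2) (h : a * u ≤ t) :
    u ≤ 2 * cutoff t a := by
  unfold cutoff
  split_ifs with h0
  · linarith
  · have : 0 < a := lt_of_le_of_ne ha (Ne.symm h0)
    have h1 : u / 2 ≤ min (t / (2 * a)) 1 := by
      refine le_min ?_ (by linarith)
      rw [le_div_iff₀ (by positivity)]
      linarith
    linarith

lemma le_mul_cutoff {t a R : ℝ} (ha : 0 ≤ a) (ha1 : a ≤ 1) (hR : 1 ≤ R) (ht : 0 ≤ t)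
    (htR : t ≤ 2 * R) : t ≤ 2 * R * cutoff t a := by
  unfold cutoff
  split_ifs with h0
  · linarith
  · have : 0 < a := lt_of_le_of_ne ha (Ne.symm h0)
    rw [mul_min_of_nonneg _ _ (by linarith)]
    refine le_min ?_ (by linarith)
    have : 2 * R * (t / (2 * a)) = R * t / a := by field_simp
    rw [this, le_div_iff₀ ‹_›]
    nlinarith [mul_nonneg ht (sub_nonneg.2 ha1), mul_nonneg ht (sub_nonneg.2 hR)]

lemma betaConst1_pos {β : ℝ} (hβ : -1 < β) : 0 < betaConst1 β := by
  unfold betaConst1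
  have h1 : 0 < Real.Gamma (3 / 2 + β) := Real.Gamma_pos_of_pos (by linarith)
  have h2 : 0 < Real.Gamma (β + 1) := Real.Gamma_pos_of_pos (by linarith)
  have := Real.pi_pos
  positivity

lemma one_sub_sq_rpow_le {β M y : ℝ} (hM : 0 < M) (hy : |y| ≤ 1) (hyM : 1 - y ≤ 2 * M)
    (h : 0 ≤ β ∨ M ≤ 1 - y ^ 2) : (1 - y ^ 2) ^ β ≤ 4 ^ |β| * M ^ β := by
  obtain ⟨hy1, hy2⟩ := abs_le.1 hy
  rcases le_or_gt 0 β with hβ | hβ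
  · rw [abs_of_nonneg hβ, ← Real.mul_rpow (by norm_num) hM.le]
    exact Real.rpow_le_rpow (by nlinarith) (by nlinarith) hβ
  · calc (1 - y ^ 2) ^ β ≤ M ^ β :=
          Real.rpow_le_rpow_of_nonpos hM (h.resolve_left hβ.not_ge) hβ.le
      _ ≤ 4 ^ |β| * M ^ β :=
          le_mul_of_one_le_left (Real.rpow_nonneg hM.le β)
            (Real.one_le_rpow (by norm_num) (abs_nonneg β))

/-- The graph map over the coordinate hyperplane `x k = 0` parametrizing `{y | ⟪y, v⟫ = s}`. -/
def graphMap {n : ℕ} (v : EuclideanSpace ℝ (Fin (n + 1))) (s : ℝ) (k : Fin (n + 1))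
    (x : Fin n → ℝ) : EuclideanSpace ℝ (Fin (n + 1)) :=
  WithLp.toLp 2 (k.insertNth ((s - ∑ j, v (k.succAbove j) * x j) / v k) x : Fin (n + 1) → ℝ)

lemma exists_lipschitzWith_graphMap (n : ℕ) : ∃ K : NNReal,
    ∀ (v : EuclideanSpace ℝ (Fin (n + 1))) (s : ℝ) (k : Fin (n + 1)),
      (∀ i, 0 ≤ v i) → (∀ i, v i ≤ v k) → 0 < v k → LipschitzWith K (graphMap v s k) := by
  refine ⟨_, fun v s k hv hmax hk =>
    (PiLp.lipschitzWith_toLp 2 (fun _ : Fin (n + 1) => ℝ)).comp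
      (LipschitzWith.of_dist_le_mul (K := (n + 1 : NNReal)) fun x y => ?_)⟩
  rw [dist_pi_le_iff (by positivity)]
  have hd : 0 ≤ dist x y := dist_nonneg
  have hn : (0 : ℝ) ≤ n := n.cast_nonneg
  have hj : ∀ j, |y j - x j| ≤ dist x y := fun j => by
    rw [← Real.dist_eq, dist_comm]; exact dist_le_pi_dist x y j
  push_cast
  refine (Fin.forall_iff_succAbove k).2 ⟨?_, fun j => ?_⟩
  · simp only [Fin.insertNth_apply_same]
    rw [Real.dist_eq, ← sub_div, abs_div, abs_of_pos hk, div_le_iff₀ hk]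
    calc |s - ∑ j, v (k.succAbove j) * x j - (s - ∑ j, v (k.succAbove j) * y j)|
        = |∑ j, v (k.succAbove j) * (y j - x j)| := by
          simp only [mul_sub, Finset.sum_sub_distrib]; congr 1; ring
      _ ≤ ∑ j : Fin n, |v (k.succAbove j) * (y j - x j)| := Finset.abs_sum_le_sum_abs _ _
      _ ≤ ∑ _j : Fin n, v k * dist x y := by
          refine Finset.sum_le_sum fun j _ => ?_
          rw [abs_mul, abs_of_nonneg (hv _)]
          exact mul_le_mul (hmax _) (hj j) (abs_nonneg _) hk.le
      _ ≤ (n + 1) * dist x y * v k := by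
          simp only [Finset.sum_const, Finset.card_univ, Fintype.card_fin, nsmul_eq_mul]
          nlinarith [mul_nonneg hk.le hd]
  · simp only [Fin.insertNth_apply_succAbove]
    have := dist_le_pi_dist x y j
    nlinarith [mul_nonneg hn hd]

lemma inner_eq_sum_mul {m : ℕ} (y v : EuclideanSpace ℝ (Fin m)) :
    (⟪y, v⟫ : ℝ) = ∑ i, v i * y i := by
  simp [PiLp.inner_apply]

lemma one_sub_le_of_mem_metaSection {m : ℕ} {v y : EuclideanSpace ℝ (Fin m)} {s : ℝ}
    (hv : ∀ i, 0 ≤ v i) (hy : y ∈ metaSection v s) (i : Fin m) :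
    1 - y i ≤ 2 * cutoff ((∑ j, v j) - s) (v i) := by
  obtain ⟨hy1, hys⟩ := hy
  have h1 := fun j => abs_le.1 (hy1 j)
  refine le_two_mul_cutoff (hv i) (by linarith [(h1 i).1]) ?_
  have : (∑ j, v j) - s = ∑ j, v j * (1 - y j) := by
    rw [← hys, inner_eq_sum_mul]
    simp [mul_sub]
  rw [this]
  exact Finset.single_le_sum (f := fun j => v j * (1 - y j))
    (fun j _ => mul_nonneg (hv j) (by linarith [(h1 j).2])) (Finset.mem_univ i)

lemma metaSection_subset_image_graphMap {n : ℕ} {v : EuclideanSpace ℝ (Fin (n + 1))} {s : ℝ}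
    {k : Fin (n + 1)} (hv : ∀ i, 0 ≤ v i) (hk : 0 < v k) :
    metaSection v s ⊆ graphMap v s k '' Set.Icc
      (fun j => 1 - 2 * cutoff ((∑ i, v i) - s) (v (k.succAbove j))) (fun _ => 1) := by
  intro y hy
  refine ⟨fun j => y (k.succAbove j), ⟨fun j => ?_, fun j => ?_⟩, ?_⟩
  · have := one_sub_le_of_mem_metaSection hv hy (k.succAbove j)
    simp only
    linarith
  · exact (abs_le.1 (hy.1 _)).2
  · have hs := hy.2
    rw [inner_eq_sum_mul, Fin.sum_univ_succAbove _ k] at hs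
    ext i
    revert i
    refine (Fin.forall_iff_succAbove k).2 ⟨?_, fun j => ?_⟩
    · simp only [graphMap, Fin.insertNth_apply_same]
      rw [div_eq_iff hk.ne']
      linarith
    · simp [graphMap]

lemma hausdorffMeasure_metaSection_le {n : ℕ} {K : NNReal}
    {v : EuclideanSpace ℝ (Fin (n + 1))} {s : ℝ} {k : Fin (n + 1)} (hv : ∀ i, 0 ≤ v i)
    (hk : 0 < v k) (hK : LipschitzWith K (graphMap v s k)) (hs : s < ∑ i, v i) :
    μH[(n : ℝ)] (metaSection v s) ≤ ENNReal.ofReal ((K : ℝ) ^ n *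
      ∏ j : Fin n, 2 * cutoff ((∑ i, v i) - s) (v (k.succAbove j))) := by
  have hpi : (μH[(n : ℝ)] : Measure (Fin n → ℝ)) = volume := by
    simpa using hausdorffMeasure_pi_real (ι := Fin n)
  refine (measure_mono (metaSection_subset_image_graphMap hv hk)).trans
    ((hK.hausdorffMeasure_image_le n.cast_nonneg _).trans ?_)
  rw [hpi, Real.volume_Icc_pi, ENNReal.ofReal_mul (by positivity), ENNReal.rpow_natCast,
    ENNReal.ofReal_pow K.coe_nonneg, ENNReal.ofReal_coe_nnreal, ENNReal.ofReal_prod_of_nonneg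
      fun j _ => mul_nonneg zero_le_two (cutoff_pos (sub_pos.2 hs) (hv _)).le]
  simp

lemma density_le_of_mem_metaSection {m : ℕ} {β : Fin m → ℝ} (hβ : ∀ i, -1 < β i)
    (hβ0 : 2 ≤ m → ∀ i, 0 ≤ β i) {v y : EuclideanSpace ℝ (Fin m)} {s : ℝ} (hnorm : ‖v‖ = 1)
    (hv : ∀ i, 0 ≤ v i) (hs : s < ∑ i, v i) (hs0 : m = 1 → 0 ≤ s)
    (hy : y ∈ metaSection v s) :
    ‖∏ i, betaConst1 (β i) * (1 - y i ^ 2) ^ (β i)‖ ≤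
      (∏ i, betaConst1 (β i) * 4 ^ |β i|) * ∏ i, cutoff ((∑ j, v j) - s) (v i) ^ (β i) := by
  have hsq : ∀ i, 0 ≤ 1 - y i ^ 2 := fun i => by
    have := abs_le.1 (hy.1 i)
    nlinarith
  have hnn : ∀ i, 0 ≤ betaConst1 (β i) * (1 - y i ^ 2) ^ (β i) := fun i =>
    mul_nonneg (betaConst1_pos (hβ i)).le (Real.rpow_nonneg (hsq i) _)
  rw [Real.norm_of_nonneg (Finset.prod_nonneg fun i _ => hnn i), ← Finset.prod_mul_distrib]
  refine Finset.prod_le_prod (fun i _ => hnn i) fun i _ => ?_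
  rw [mul_assoc]
  refine mul_le_mul_of_nonneg_left (one_sub_sq_rpow_le (cutoff_pos (sub_pos.2 hs) (hv i))
    (hy.1 i) (one_sub_le_of_mem_metaSection hv hy i) ?_) (betaConst1_pos (hβ i)).le
  by_cases hm : 2 ≤ m
  · exact Or.inl (hβ0 hm i)
  · right
    obtain rfl : m = 1 := by have := i.pos; omega
    obtain rfl : i = 0 := Subsingleton.elim _ _
    have h1 : v 0 = 1 := by
      have := EuclideanSpace.norm_eq v
      simpa [hnorm, Real.sqrt_sq_eq_abs, abs_of_nonneg (hv 0)] using this.symm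
    have hys : y 0 = s := by simpa [inner_eq_sum_mul, h1] using hy.2
    have h0 := hs0 rfl
    simp only [Finset.univ_unique, Fin.default_eq_zero, Finset.sum_singleton, h1] at hs ⊢
    rw [hys]
    refine (show cutoff (1 - s) 1 ≤ (1 - s) / 2 by simp [cutoff]).trans ?_
    nlinarith

/-- **Lemma 3.2, section part**: upper bound for the weighted surface content of a
meta-section: `Vol_{m−1}(C(v,s);β) ≲ (‖v‖_1−s)^{−1} ∏_i (min{(‖v‖_1−s)/(2v_i),1})^{β_i+1}`,
the minimum being interpreted as `1` when `v_i = 0`. -/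
theorem metaSection_content_upper
    (m : ℕ) (hm : 1 ≤ m) (β : Fin m → ℝ) (hβ : ∀ i, -1 < β i)
    (hβ0 : 2 ≤ m → ∀ i, 0 ≤ β i) :
    ∃ C : ℝ, 0 < C ∧
      ∀ (v : EuclideanSpace ℝ (Fin m)) (s : ℝ),
        ‖v‖ = 1 → (∀ i, 0 ≤ v i) → -(∑ i, v i) < s → s < ∑ i, v i →
        (m = 1 → 0 ≤ s) →
        metaSectionContent β v s
          ≤ C * ((∑ i, v i) - s)⁻¹ *
            ∏ i, (if v i = 0 then 1 else
              min (((∑ j, v j) - s) / (2 * v i)) 1) ^ (β i + 1) := by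
  obtain ⟨n, rfl⟩ : ∃ n, m = n + 1 := ⟨m - 1, by omega⟩
  obtain ⟨K, hK⟩ := exists_lipschitzWith_graphMap n
  set D : ℝ := ∏ i, betaConst1 (β i) * 4 ^ |β i| with hD
  have hDpos : 0 < D := Finset.prod_pos fun i _ =>
    mul_pos (betaConst1_pos (hβ i)) (Real.rpow_pos_of_pos (by norm_num) _)
  refine ⟨D * ((K : ℝ) + 1) ^ n * 2 ^ n * (2 * (n + 1)), by positivity,
    fun v s hnorm hv hs' hs hs0 => ?_⟩
  change _ ≤ _ * ∏ i, cutoff ((∑ j, v j) - s) (v i) ^ (β i + 1)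
  obtain ⟨k, hmax⟩ := Finite.exists_max v
  have hv1 : ∀ i, v i ≤ 1 := fun i => by
    have := PiLp.norm_apply_le v i
    rw [hnorm] at this
    exact (le_abs_self _).trans this
  have hk : 0 < v k := by
    refine lt_of_le_of_ne (hv k) fun h => ?_
    have hz : v = 0 := by
      ext i
      exact le_antisymm ((hmax i).trans h.ge) (hv i)
    simp [hz] at hnorm
  have hsum : ∑ i, v i ≤ n + 1 := by
    simpa using Finset.sum_le_sum fun i (_ : i ∈ Finset.univ) => hv1 i
  set t : ℝ := (∑ j, v j) - s with ht
  have htpos : 0 < t := sub_pos.2 hs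
  have hM : ∀ i, 0 < cutoff t (v i) := fun i => cutoff_pos htpos (hv i)
  set P : ℝ := ∏ i, cutoff t (v i) ^ (β i) with hP
  set Q : ℝ := ∏ j : Fin n, cutoff t (v (k.succAbove j)) with hQ
  have hPnn : 0 ≤ P := Finset.prod_nonneg fun i _ => Real.rpow_nonneg (hM i).le _
  have hQnn : 0 ≤ Q := Finset.prod_nonneg fun j _ => (hM _).le
  have hdim : ((n + 1 : ℕ) : ℝ) - 1 = n := by push_cast; ring
  have hmeas := hausdorffMeasure_metaSection_le hv hk (hK v s k hv hmax hk) hs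
  rw [Finset.prod_mul_distrib, Finset.prod_const, Finset.card_univ, Fintype.card_fin,
    ← ht, ← hQ] at hmeas
  have hreal : (μH[(n : ℝ)]).real (metaSection v s) ≤ (K : ℝ) ^ n * (2 ^ n * Q) :=
    ENNReal.toReal_le_of_le_ofReal (by positivity) hmeas
  have hint : metaSectionContent β v s ≤ D * P * (μH[(n : ℝ)]).real (metaSection v s) := by
    unfold metaSectionContent
    rw [hdim]
    exact (le_abs_self _).trans (norm_setIntegral_le_of_norm_le_const
      (hmeas.trans_lt ENNReal.ofReal_lt_top)
      fun y hy => density_le_of_mem_metaSection hβ hβ0 hnorm hv hs hs0 hy)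
  have hprod : ∏ i, cutoff t (v i) ^ (β i + 1) = P * (cutoff t (v k) * Q) := by
    rw [hP, hQ, ← Fin.prod_univ_succAbove (fun i => cutoff t (v i)) k,
      ← Finset.prod_mul_distrib]
    exact Finset.prod_congr rfl fun i _ => Real.rpow_add_one (hM i).ne' _
  have hkt : 1 ≤ t⁻¹ * (2 * (n + 1) * cutoff t (v k)) := by
    rw [inv_mul_eq_div, le_div_iff₀ htpos, one_mul]
    exact le_mul_cutoff hk.le (hv1 k) (by simp) htpos.le (by linarith)
  rw [hprod]
  calc metaSectionContent β v s ≤ D * P * ((K : ℝ) ^ n * (2 ^ n * Q)) :=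
        hint.trans (by gcongr)
    _ ≤ D * P * (((K : ℝ) + 1) ^ n * (2 ^ n * Q)) := by gcongr; linarith
    _ ≤ D * P * (((K : ℝ) + 1) ^ n * (2 ^ n * Q)) *
          (t⁻¹ * (2 * (n + 1) * cutoff t (v k))) :=
        le_mul_of_one_le_right (by positivity) hkt
    _ = _ := by ring
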